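/- Beauville–Laszlo gluing for functions: Let A be a Noetherian commutative ring, f ∈ A, Â the f-adic completion, A_f the localization at f, and Â_f = A_f ⊗_A Â. Given a ∈ A_f and b ∈ Â whose images in Â_f agree, there exists a unique c ∈ A mapping to a in A_f and to b in Â. -/

import Mathlib

/-- In a Noetherian ring the `f`-power torsion is killed by a single power of `f`. -/
theorem exists_pow_mul_eq_zero_of_pow_mul_eq_zero {A : Type*} [CommRing A] [IsNoetherianRing A]
    (f : A) : ∃ K : ℕ, ∀ (n : ℕ) (s : A), f ^ n * s = 0 → f ^ K * s = 0 := by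
  let T : ℕ →o Ideal A :=
    { toFun := fun n => Submodule.torsionBy A A (f ^ n)
      monotone' := fun m n hmn => Submodule.torsionBy_le_torsionBy_of_dvd _ _ (pow_dvd_pow f hmn) }
  obtain ⟨K, hK⟩ := monotone_stabilizes_iff_noetherian.mpr ‹IsNoetherian A A› T
  refine ⟨K, fun n s hs => ?_⟩
  have hs' : s ∈ T (max K n) := T.monotone (le_max_right K n) hs
  rw [← hK _ (le_max_left K n)] at hs'
  exact hs'

/-- The `f`-power torsion of a Noetherian ring meets a high enough power of `(f)` trivially. -/
theorem exists_eq_zero_of_pow_dvd_of_pow_mul_eq_zero {A : Type*} [CommRing A] [IsNoetherianRing A]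
    (f : A) : ∃ K : ℕ, ∀ (n : ℕ) (s : A), f ^ K ∣ s → f ^ n * s = 0 → s = 0 := by
  obtain ⟨K, hK⟩ := exists_pow_mul_eq_zero_of_pow_mul_eq_zero f
  refine ⟨K, ?_⟩
  rintro n _ ⟨t, rfl⟩ hs
  exact hK (n + K) t (by rw [pow_add, mul_assoc, hs])

namespace AdicCompletion

variable {A : Type*} [CommRing A] {f : A}

theorem pow_dvd_sub_of_le (r : AdicCauchySequence (Ideal.span {f}) A) {m n : ℕ} (hmn : m ≤ n) :
    f ^ m ∣ r.val n - r.val m := by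
  rw [← Ideal.mem_span_singleton, ← Ideal.span_singleton_pow, ← Ideal.Quotient.eq]
  exact Ideal.mk_eq_mk _ hmn r

theorem algebraMap_mul_mk_eq_algebraMap_iff (r : AdicCauchySequence (Ideal.span {f}) A) (u c : A) :
    algebraMap A (AdicCompletion (Ideal.span {f}) A) u * mk (Ideal.span {f}) A r =
        algebraMap A (AdicCompletion (Ideal.span {f}) A) c ↔
      ∀ n, f ^ n ∣ u * r.val n - c := by
  have key (n : ℕ) : evalₐ (Ideal.span {f}) n
        (algebraMap A (AdicCompletion (Ideal.span {f}) A) u * mk (Ideal.span {f}) A r) =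
      evalₐ (Ideal.span {f}) n (algebraMap A (AdicCompletion (Ideal.span {f}) A) c) ↔
        f ^ n ∣ u * r.val n - c := by
    rw [← Ideal.mem_span_singleton, ← Ideal.span_singleton_pow, ← Ideal.Quotient.eq, map_mul,
      AlgHom.commutes, AlgHom.commutes, evalₐ_mk, map_mul]
    rfl
  exact ⟨fun h n => (key n).mp (by rw [h]), fun h => ext_evalₐ fun n => (key n).mpr (h n)⟩

/-- For `A` Noetherian, every element of the completion killed by a power of `f` comes from an
element of `A` killed by the same power. -/
theorem exists_algebraMap_eq_of_pow_mul_eq_zero [IsNoetherianRing A] {N : ℕ}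
    {z : AdicCompletion (Ideal.span {f}) A} (hz : algebraMap A _ (f ^ N) * z = 0) :
    ∃ c : A, f ^ N * c = 0 ∧ algebraMap A _ c = z := by
  obtain ⟨K, hK⟩ := exists_eq_zero_of_pow_dvd_of_pow_mul_eq_zero f
  obtain ⟨r, rfl⟩ := mk_surjective _ _ z
  replace hz := (algebraMap_mul_mk_eq_algebraMap_iff r _ 0).mp (hz.trans (_root_.map_zero _).symm)
  have hlift (k : ℕ) : ∃ c : A, f ^ N * c = 0 ∧ f ^ k ∣ r.val (N + k) - c := by
    obtain ⟨t, ht⟩ := hz (N + k)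
    exact ⟨r.val (N + k) - f ^ k * t, by linear_combination ht, t, by ring⟩
  obtain ⟨c, hc, hcK⟩ := hlift K
  refine ⟨c, hc, ?_⟩
  rw [← one_mul (mk _ _ r), ← map_one (algebraMap A _), eq_comm,
    algebraMap_mul_mk_eq_algebraMap_iff]
  intro n
  obtain ⟨c', hc', hcn⟩ := hlift (K + n)
  have hrK : f ^ K ∣ r.val (N + (K + n)) - r.val (N + K) :=
    (pow_dvd_pow f (by lia)).trans (pow_dvd_sub_of_le r (show N + K ≤ N + (K + n) by lia))
  have heq : c' - c = 0 := by
    refine hK N _ ?_ (by linear_combination hc' - hc)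
    convert dvd_sub (dvd_add hcK hrK) ((pow_dvd_pow f (Nat.le_add_right K n)).trans hcn) using 1
    ring
  rw [← sub_eq_zero.mp heq]
  convert dvd_sub ((pow_dvd_pow f (Nat.le_add_left n K)).trans hcn)
    (pow_dvd_sub_of_le r (show n ≤ N + (K + n) by lia)) using 1
  ring

theorem pow_dvd_of_algebraMap_eq {x : A} {N : ℕ} {b : AdicCompletion (Ideal.span {f}) A}
    (h : algebraMap A _ (f ^ N) * b = algebraMap A _ x) : f ^ N ∣ x := by
  obtain ⟨r, rfl⟩ := mk_surjective _ _ b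
  rw [algebraMap_mul_mk_eq_algebraMap_iff] at h
  exact (dvd_sub_right (dvd_mul_right _ _)).mp (h N)

/-- A localized element agreeing with a completed one comes from the base ring. -/
theorem exists_algebraMap_away_eq (a : Localization.Away f)
    (b : AdicCompletion (Ideal.span {f}) A)
    (h : IsLocalization.Away.map (Localization.Away f)
          (Localization.Away (algebraMap A (AdicCompletion (Ideal.span {f}) A) f))
          (algebraMap A (AdicCompletion (Ideal.span {f}) A)) f a
        = algebraMap (AdicCompletion (Ideal.span {f}) A)
            (Localization.Away (algebraMap A (AdicCompletion (Ideal.span {f}) A) f)) b) :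
    ∃ (y : A) (N : ℕ), algebraMap A (Localization.Away f) y = a ∧
      algebraMap A _ (f ^ N) * (b - algebraMap A _ y) = 0 := by
  obtain ⟨n, x, hx⟩ := IsLocalization.Away.surj f a
  have hloc := congrArg (IsLocalization.Away.map (Localization.Away f)
    (Localization.Away (algebraMap A (AdicCompletion (Ideal.span {f}) A) f))
    (algebraMap A (AdicCompletion (Ideal.span {f}) A)) f) hx
  rw [map_mul, h, map_pow] at hloc
  simp only [IsLocalization.Away.map, IsLocalization.map_eq] at hloc
  rw [← map_pow, ← map_mul] at hloc
  obtain ⟨m, hm⟩ := IsLocalization.Away.exists_of_eq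
    (algebraMap A (AdicCompletion (Ideal.span {f}) A) f) hloc
  have hb : algebraMap A (AdicCompletion (Ideal.span {f}) A) (f ^ (m + n)) * b =
      algebraMap A _ (f ^ m * x) := by
    simp only [map_mul, map_pow, pow_add]
    linear_combination hm
  obtain ⟨y, hy⟩ := pow_dvd_of_algebraMap_eq hb
  refine ⟨y, m + n, ?_, ?_⟩
  · apply (IsLocalization.Away.algebraMap_pow_isUnit f (m + n)).mul_left_cancel
    rw [← map_pow, ← map_mul, ← hy, map_mul, ← hx, map_pow, map_pow]
    ring
  · rw [mul_sub, hb, ← map_mul, hy, sub_self]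

/-- An element vanishing both in the localization and in the completion is zero. -/
theorem eq_zero_of_algebraMap_eq_zero [IsNoetherianRing A] {c : A}
    (ha : algebraMap A (Localization.Away f) c = 0)
    (hb : algebraMap A (AdicCompletion (Ideal.span {f}) A) c = 0) : c = 0 := by
  obtain ⟨K, hK⟩ := exists_eq_zero_of_pow_dvd_of_pow_mul_eq_zero f
  obtain ⟨n, hn⟩ := IsLocalization.Away.exists_of_eq f (ha.trans (_root_.map_zero _).symm)
  exact hK n c (pow_dvd_of_algebraMap_eq (b := 0) (by rw [mul_zero, hb])) (by rw [hn, mul_zero])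

end AdicCompletion

/-- Beauville–Laszlo gluing for functions: for `A` Noetherian, `f ∈ A`, given
`a ∈ A_f` and `b ∈ Â` (the `f`-adic completion) with the same image in `Â_f`,
there is a unique `c ∈ A` mapping to `a` and to `b`. -/
theorem beauville_laszlo_gluing_functions
    {A : Type*} [CommRing A] [IsNoetherianRing A] (f : A)
    (a : Localization.Away f) (b : AdicCompletion (Ideal.span {f}) A)
    (h : IsLocalization.Away.map (Localization.Away f)
          (Localization.Away (algebraMap A (AdicCompletion (Ideal.span {f}) A) f))
          (algebraMap A (AdicCompletion (Ideal.span {f}) A)) f a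
        = algebraMap (AdicCompletion (Ideal.span {f}) A)
            (Localization.Away (algebraMap A (AdicCompletion (Ideal.span {f}) A) f)) b) :
    ∃! c : A, algebraMap A (Localization.Away f) c = a ∧
      algebraMap A (AdicCompletion (Ideal.span {f}) A) c = b := by
  obtain ⟨y, N, hya, hyb⟩ := AdicCompletion.exists_algebraMap_away_eq a b h
  obtain ⟨c, hc, hcb⟩ := AdicCompletion.exists_algebraMap_eq_of_pow_mul_eq_zero hyb
  have hca : algebraMap A (Localization.Away f) c = 0 := by
    apply (IsLocalization.Away.algebraMap_pow_isUnit f N).mul_left_cancel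
    rw [← map_pow, ← map_mul, hc, map_zero, mul_zero]
  refine ⟨y + c, ⟨by rw [map_add, hca, hya, add_zero], by rw [map_add, hcb, add_sub_cancel]⟩, ?_⟩
  rintro d ⟨hda, hdb⟩
  refine sub_eq_zero.mp (AdicCompletion.eq_zero_of_algebraMap_eq_zero (f := f) ?_ ?_)
  · rw [map_sub, map_add, hda, hca, hya, add_zero, sub_self]
  · rw [map_sub, map_add, hdb, hcb, add_sub_cancel, sub_self]
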